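/- Let z be an irrational real number, with negative regular continued fraction expansion z = ⌈c_0, c_1, c_2, …⌉ and ⌈ ⌉-convergents s_j/t_j. For every j ≥ 1, the fraction s_j/t_j is a ⌊ ⌋-convergent of z (i.e., equals p_k/q_k for some k ≥ 0, where p_k/q_k are the convergents of the regular continued fraction expansion of z) if and only if c_{j+1} ≥ 3. -/

import Mathlib

open Filter Finset

/-- Complete quotients of the regular continued fraction: `rX z n` is `z_n`,
with `z_0 = z` and `z_{n+1} = 1/(z_n - ⌊z_n⌋)`. -/
noncomputable def rXaux : ℕ → ℝ → ℝ
  | 0, z => z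
  | n + 1, z => rXaux n (1 / (z - ⌊z⌋))

noncomputable def rX (z : ℝ) (n : ℕ) : ℝ := rXaux n z

/-- Partial quotients of the regular continued fraction: `rA z n` is `a_n = ⌊z_n⌋`. -/
noncomputable def rA (z : ℝ) (n : ℕ) : ℤ := ⌊rX z n⌋

/-- Numerators of the regular (⌊ ⌋-)convergents, with shifted index:
`rP z 0 = p_{-1} = 1` and `rP z (k+1) = p_k`. -/
noncomputable def rP (z : ℝ) : ℕ → ℤ
  | 0 => 1
  | 1 => rA z 0
  | n + 2 => rA z (n + 1) * rP z (n + 1) + rP z n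

/-- Denominators of the regular (⌊ ⌋-)convergents, with shifted index:
`rQ z 0 = q_{-1} = 0` and `rQ z (k+1) = q_k`. -/
noncomputable def rQ (z : ℝ) : ℕ → ℤ
  | 0 => 0
  | 1 => 1
  | n + 2 => rA z (n + 1) * rQ z (n + 1) + rQ z n

/-- Complete quotients of the negative regular continued fraction: `nX z n` is `z_n`,
with `z_0 = z` and `z_{n+1} = 1/(⌈z_n⌉ - z_n)`. -/
noncomputable def nXaux : ℕ → ℝ → ℝ
  | 0, z => z
  | n + 1, z => nXaux n (1 / (⌈z⌉ - z))

noncomputable def nX (z : ℝ) (n : ℕ) : ℝ := nXaux n z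

/-- Partial quotients of the negative regular continued fraction: `nC z n` is `c_n = ⌈z_n⌉`. -/
noncomputable def nC (z : ℝ) (n : ℕ) : ℤ := ⌈nX z n⌉

/-- Numerators of the negative regular (⌈ ⌉-)convergents, with shifted index:
`nS z 0 = s_{-1} = 1` and `nS z (j+1) = s_j`. -/
noncomputable def nS (z : ℝ) : ℕ → ℤ
  | 0 => 1
  | 1 => nC z 0
  | n + 2 => nC z (n + 1) * nS z (n + 1) - nS z n

/-- Denominators of the negative regular (⌈ ⌉-)convergents, with shifted index:
`nT z 0 = t_{-1} = 0` and `nT z (j+1) = t_j`. -/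
noncomputable def nT (z : ℝ) : ℕ → ℤ
  | 0 => 0
  | 1 => 1
  | n + 2 => nC z (n + 1) * nT z (n + 1) - nT z n

theorem rXaux_succ (n : ℕ) (z : ℝ) :
    rXaux (n + 1) z = 1 / (rXaux n z - ⌊rXaux n z⌋) := by
  induction n generalizing z with
  | zero => rfl
  | succ n ih => exact ih (1 / (z - ⌊z⌋))

theorem rX_succ (z : ℝ) (n : ℕ) : rX z (n + 1) = 1 / (rX z n - rA z n) :=
  rXaux_succ n z

theorem nXaux_succ (n : ℕ) (z : ℝ) :
    nXaux (n + 1) z = 1 / (⌈nXaux n z⌉ - nXaux n z) := by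
  induction n generalizing z with
  | zero => rfl
  | succ n ih => exact ih (1 / (⌈z⌉ - z))

theorem nX_succ (z : ℝ) (n : ℕ) : nX z (n + 1) = 1 / (nC z n - nX z n) :=
  nXaux_succ n z

theorem irrational_rX {z : ℝ} (hz : Irrational z) (n : ℕ) : Irrational (rX z n) := by
  induction n with
  | zero => exact hz
  | succ n ih =>
    rw [rX_succ, one_div]
    exact (ih.sub_intCast _).inv

theorem rA_lt_rX {z : ℝ} (hz : Irrational z) (n : ℕ) : (rA z n : ℝ) < rX z n :=
  lt_of_le_of_ne (Int.floor_le _) ((irrational_rX hz n).ne_int _).symm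

theorem rX_lt_rA_add_one (z : ℝ) (n : ℕ) : rX z n < rA z n + 1 :=
  Int.lt_floor_add_one _

theorem one_lt_rX_succ {z : ℝ} (hz : Irrational z) (n : ℕ) : 1 < rX z (n + 1) := by
  rw [rX_succ, lt_div_iff₀ (sub_pos.2 (rA_lt_rX hz n))]
  linarith [rX_lt_rA_add_one z n]

theorem one_le_rA_succ {z : ℝ} (hz : Irrational z) (n : ℕ) : 1 ≤ rA z (n + 1) :=
  Int.le_floor.2 (by exact_mod_cast (one_lt_rX_succ hz n).le)

theorem rX_eq_rA_add_inv (z : ℝ) (n : ℕ) :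
    rX z n = rA z n + 1 / rX z (n + 1) := by
  rw [rX_succ, one_div_one_div]
  ring

theorem rQ_nonneg_pos {z : ℝ} (hz : Irrational z) (n : ℕ) : 0 ≤ rQ z n ∧ 0 < rQ z (n + 1) := by
  induction n with
  | zero => exact ⟨le_rfl, zero_lt_one⟩
  | succ n ih =>
    refine ⟨ih.2.le, ?_⟩
    have : rQ z (n + 2) = rA z (n + 1) * rQ z (n + 1) + rQ z n := rfl
    nlinarith [one_le_rA_succ hz n]

theorem monotone_rQ {z : ℝ} (hz : Irrational z) : Monotone (rQ z) := by
  refine monotone_nat_of_le_succ fun n => ?_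
  cases n with
  | zero => exact zero_le_one
  | succ n =>
    have : rQ z (n + 2) = rA z (n + 1) * rQ z (n + 1) + rQ z n := rfl
    nlinarith [one_le_rA_succ hz n, rQ_nonneg_pos hz n]

theorem rP_mul_rQ_sub (z : ℝ) (n : ℕ) :
    rP z n * rQ z (n + 1) - rQ z n * rP z (n + 1) = (-1) ^ n := by
  induction n with
  | zero => simp [rP, rQ]
  | succ n ih =>
    have hP : rP z (n + 2) = rA z (n + 1) * rP z (n + 1) + rP z n := rfl
    have hQ : rQ z (n + 2) = rA z (n + 1) * rQ z (n + 1) + rQ z n := rfl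
    rw [hP, hQ, pow_succ]
    linear_combination -ih

theorem isCoprime_of_det {a b c d : ℤ} {n : ℕ} (h : a * d - b * c = (-1) ^ n) :
    IsCoprime a b := by
  have hs : ((-1 : ℤ) ^ n) * (-1) ^ n = 1 := by
    rw [← mul_pow]
    simp
  exact ⟨(-1) ^ n * d, -((-1) ^ n * c), by linear_combination (-1) ^ n * h + hs⟩

theorem isCoprime_rP_rQ (z : ℝ) (n : ℕ) : IsCoprime (rP z n) (rQ z n) :=
  isCoprime_of_det (rP_mul_rQ_sub z n)

/-- An intermediate fraction strictly between two convergents is not a convergent. -/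
theorem intermediate_ne_convergent {z : ℝ} (hz : Irrational z) {k : ℕ} {m : ℤ} (hm : 1 ≤ m)
    (hmk : m < rA z (k + 1)) (l : ℕ) :
    ((rP z k + m * rP z (k + 1) : ℤ) : ℝ) / ((rQ z k + m * rQ z (k + 1) : ℤ) : ℝ) ≠
      (rP z (l + 1) : ℝ) / (rQ z (l + 1) : ℝ) := by
  intro h
  obtain ⟨hk0, hk1⟩ := rQ_nonneg_pos hz k
  have hl := (rQ_nonneg_pos hz l).2
  have hpos : 0 < rQ z k + m * rQ z (k + 1) := by nlinarith
  have hcross : (rP z k + m * rP z (k + 1)) * rQ z (l + 1) =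
      rP z (l + 1) * (rQ z k + m * rQ z (k + 1)) := by
    rw [div_eq_div_iff (by exact_mod_cast hpos.ne') (by exact_mod_cast hl.ne')] at h
    exact_mod_cast h
  have hcop : IsCoprime (rP z k + m * rP z (k + 1)) (rQ z k + m * rQ z (k + 1)) :=
    isCoprime_of_det (c := rP z (k + 1)) (d := rQ z (k + 1)) (n := k)
      (by linear_combination rP_mul_rQ_sub z k)
  have hQ : rQ z k + m * rQ z (k + 1) = rQ z (l + 1) := by
    refine Int.dvd_antisymm hpos.le hl.le ?_ ?_
    · exact hcop.symm.dvd_of_dvd_mul_left ⟨rP z (l + 1), by linear_combination hcross⟩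
    · exact (isCoprime_rP_rQ z (l + 1)).symm.dvd_of_dvd_mul_left
        ⟨rP z k + m * rP z (k + 1), by linear_combination -hcross⟩
  rcases le_or_gt l k with hlk | hlk
  · have hmono := monotone_rQ hz (Nat.succ_le_succ hlk)
    simp only [Nat.succ_eq_add_one] at hmono
    have hm1 : m = 1 := by nlinarith
    subst hm1
    have hk : k = 0 := by
      rcases k with _ | k
      · rfl
      · linarith [(rQ_nonneg_pos hz k).2]
    subst hk
    obtain rfl : l = 0 := by omega
    simp [rP, rQ] at hcross
  · have hmono := monotone_rQ hz (show k + 2 ≤ l + 1 by omega)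
    have : rQ z (k + 2) = rA z (k + 1) * rQ z (k + 1) + rQ z k := rfl
    nlinarith

/-- The negative continued fraction passes through the intermediate fractions of the regular one:
`(s_j, t_j) = (p_{k-1}, q_{k-1}) + m (p_k, q_k)` with step `(p_k, q_k)` from the previous term. -/
theorem exists_intermediate {z : ℝ} (hz : Irrational z) (j : ℕ) :
    ∃ (k : ℕ) (m : ℤ), 1 ≤ m ∧ m ≤ rA z (k + 1) ∧
      nS z (j + 1) = rP z k + m * rP z (k + 1) ∧ nS z j = nS z (j + 1) - rP z (k + 1) ∧
      nT z (j + 1) = rQ z k + m * rQ z (k + 1) ∧ nT z j = nT z (j + 1) - rQ z (k + 1) ∧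
      nX z (j + 1) = 1 + 1 / (rX z (k + 1) - m) ∧
      nC z (j + 1) = if m = rA z (k + 1) then rA z (k + 2) + 2 else 2 := by
  have ceil_eq (j k : ℕ) (m : ℤ) (hm : m ≤ rA z (k + 1))
      (hX : nX z (j + 1) = 1 + 1 / (rX z (k + 1) - m)) :
      nC z (j + 1) = if m = rA z (k + 1) then rA z (k + 2) + 2 else 2 := by
    split_ifs with h
    · have hx : nX z (j + 1) = 1 + rX z (k + 2) := by
        rw [hX, h, rX_succ z (k + 1)]
      rw [nC, Int.ceil_eq_iff, hx]
      push_cast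
      exact ⟨by linarith [rA_lt_rX hz (k + 2)], by linarith [rX_lt_rA_add_one z (k + 2)]⟩
    · have h1 : (m : ℝ) + 1 ≤ rA z (k + 1) := by exact_mod_cast lt_of_le_of_ne hm h
      have h2 : 1 < rX z (k + 1) - m := by linarith [rA_lt_rX hz (k + 1)]
      have h3 : 1 / (rX z (k + 1) - m) < 1 := (div_lt_one (by linarith)).2 h2
      have h4 : 0 < 1 / (rX z (k + 1) - m) := one_div_pos.2 (by linarith)
      rw [nC, Int.ceil_eq_iff, hX]
      push_cast
      exact ⟨by linarith, by linarith⟩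
  induction j with
  | zero =>
    have hC : nC z 0 = rA z 0 + 1 := by
      have h1 : rA z 0 < z := rA_lt_rX hz 0
      have h2 : z < rA z 0 + 1 := rX_lt_rA_add_one z 0
      rw [nC, Int.ceil_eq_iff]
      push_cast
      exact ⟨by simpa [nX, nXaux] using h1, h2.le⟩
    have hX : nX z (0 + 1) = 1 + 1 / (rX z (0 + 1) - (1 : ℤ)) := by
      have h1 := one_lt_rX_succ hz 0
      have h2 : z = rA z 0 + 1 / rX z (0 + 1) := rX_eq_rA_add_inv z 0
      have h3 : (nC z 0 : ℝ) - nX z 0 = 1 - 1 / rX z (0 + 1) := by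
        rw [hC, show nX z 0 = z from rfl]
        push_cast
        linarith
      rw [nX_succ, h3]
      have h4 : rX z (0 + 1) ≠ 0 := by linarith
      have h5 : rX z (0 + 1) - 1 ≠ 0 := by linarith
      push_cast
      field_simp
      ring
    refine ⟨0, 1, le_rfl, one_le_rA_succ hz 0, ?_, ?_, ?_, ?_, hX, ceil_eq 0 0 1
      (one_le_rA_succ hz 0) hX⟩ <;> simp [nS, nT, rP, rQ, hC, add_comm]
  | succ j ih =>
    obtain ⟨k, m, hm1, hmk, hS, hS', hT, hT', hX, hC⟩ := ih
    have hSs : nS z (j + 1 + 1) = nC z (j + 1) * nS z (j + 1) - nS z j := rfl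
    have hTs : nT z (j + 1 + 1) = nC z (j + 1) * nT z (j + 1) - nT z j := rfl
    have hx := one_lt_rX_succ hz k
    by_cases h : m = rA z (k + 1)
    · rw [if_pos h] at hC
      have hP1 : rP z (k + 2) = rA z (k + 1) * rP z (k + 1) + rP z k := rfl
      have hQ1 : rQ z (k + 2) = rA z (k + 1) * rQ z (k + 1) + rQ z k := rfl
      have hP2 : rP z (k + 2 + 1) = rA z (k + 2) * rP z (k + 2) + rP z (k + 1) := rfl
      have hQ2 : rQ z (k + 2 + 1) = rA z (k + 2) * rQ z (k + 2) + rQ z (k + 1) := rfl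
      have hSk : nS z (j + 1) = rP z (k + 2) := by rw [hS, hP1, h]; ring
      have hTk : nT z (j + 1) = rQ z (k + 2) := by rw [hT, hQ1, h]; ring
      have hX' : nX z (j + 1 + 1) = 1 + 1 / (rX z (k + 2 + 1) - (1 : ℤ)) := by
        have h1 := one_lt_rX_succ hz (k + 2)
        have h2 := rX_eq_rA_add_inv z (k + 2)
        have h3 : (nC z (j + 1) : ℝ) - nX z (j + 1) = 1 - 1 / rX z (k + 2 + 1) := by
          rw [hC, hX, h, ← rX_succ z (k + 1), h2]
          push_cast
          ring
        rw [nX_succ, h3]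
        have h4 : rX z (k + 2 + 1) ≠ 0 := by linarith
        have h5 : rX z (k + 2 + 1) - 1 ≠ 0 := by linarith
        push_cast
        field_simp
        ring
      have hA := one_le_rA_succ hz (k + 2)
      refine ⟨k + 2, 1, le_rfl, hA, ?_, ?_, ?_, ?_, hX', ceil_eq _ _ _ hA hX'⟩
      · rw [hSs, hC, hS', hP2, hSk]; ring
      · rw [hSs, hC, hS', hP2, hSk]; ring
      · rw [hTs, hC, hT', hQ2, hTk]; ring
      · rw [hTs, hC, hT', hQ2, hTk]; ring
    · rw [if_neg h] at hC
      have hA : m + 1 ≤ rA z (k + 1) := lt_of_le_of_ne hmk h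
      have hX' : nX z (j + 1 + 1) = 1 + 1 / (rX z (k + 1) - (m + 1 : ℤ)) := by
        have h1 : (m : ℝ) + 1 ≤ rA z (k + 1) := by exact_mod_cast hA
        have h2 := rA_lt_rX hz (k + 1)
        have h3 : rX z (k + 1) - m ≠ 0 := by linarith
        have h4 : rX z (k + 1) - m - 1 ≠ 0 := by linarith
        have h5 : (nC z (j + 1) : ℝ) - nX z (j + 1) =
            (rX z (k + 1) - m - 1) / (rX z (k + 1) - m) := by
          rw [hC, hX]
          push_cast
          field_simp
          ring
        rw [nX_succ, h5]
        push_cast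
        rw [← sub_sub]
        field_simp
        ring
      refine ⟨k, m + 1, by omega, hA, ?_, ?_, ?_, ?_, hX', ceil_eq _ _ _ hA hX'⟩
      · rw [hSs, hC, hS', hS]; ring
      · rw [hSs, hC, hS', hS]; ring
      · rw [hTs, hC, hT', hT]; ring
      · rw [hTs, hC, hT', hT]; ring

/-- For irrational `z` and `j ≥ 1`, the ⌈ ⌉-convergent `s_j/t_j` is a
⌊ ⌋-convergent of `z` (i.e. equals `p_k/q_k` for some `k ≥ 0`) iff `c_{j+1} ≥ 3`. -/
theorem stmt0 (z : ℝ) (hz : Irrational z) (j : ℕ) (hj : 1 ≤ j) :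
    (∃ k : ℕ, (nS z (j + 1) : ℝ) / (nT z (j + 1) : ℝ) = (rP z (k + 1) : ℝ) / (rQ z (k + 1) : ℝ))
      ↔ 3 ≤ nC z (j + 1) := by
  obtain ⟨k, m, hm1, hmk, hS, -, hT, -, -, hC⟩ := exists_intermediate hz j
  by_cases h : m = rA z (k + 1)
  · rw [if_pos h] at hC
    refine iff_of_true ⟨k + 1, ?_⟩ (by linarith [one_le_rA_succ hz (k + 1)])
    rw [hS, hT, h, add_comm (rP z k), add_comm (rQ z k)]
    rfl
  · rw [if_neg h] at hC
    refine iff_of_false ?_ (by omega)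
    rintro ⟨l, hl⟩
    rw [hS, hT] at hl
    exact intermediate_ne_convergent hz hm1 (lt_of_le_of_ne hmk h) l hl
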